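/- For all strictly positive operators A, B, P on a complex Hilbert space H, S(P|B) − S(P|A) = ∫₀^∞ [ ∫₀¹ P((1−t)A + tB + λP)⁻¹ (B − A) ((1−t)A + tB + λP)⁻¹ P dt ] dλ. -/

import Mathlib

open MeasureTheory

variable {H : Type*} [NormedAddCommGroup H] [InnerProductSpace ℂ H] [CompleteSpace H]

/-- An operator `T` on a complex Hilbert space is *strictly positive* if
`⟪T x, x⟫ ≥ 0` for all `x` and `T` is invertible. -/
def StrictlyPos (T : H →L[ℂ] H) : Prop := T.IsPositive ∧ IsUnit T

/-- `A^{1/2}` via the continuous functional calculus. -/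
noncomputable def opSqrt (A : H →L[ℂ] H) : H →L[ℂ] H := cfc Real.sqrt A

/-- `A^{-1/2}` via the continuous functional calculus. -/
noncomputable def opInvSqrt (A : H →L[ℂ] H) : H →L[ℂ] H :=
  cfc (fun x : ℝ => (Real.sqrt x)⁻¹) A

/-- The noncommutative perspective `𝒫_f(B, A) := A^{1/2} f(A^{-1/2} B A^{-1/2}) A^{1/2}`. -/
noncomputable def persp (f : ℝ → ℝ) (B A : H →L[ℂ] H) : H →L[ℂ] H :=
  opSqrt A * cfc f (opInvSqrt A * B * opInvSqrt A) * opSqrt A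

/-- The weighted operator geometric mean `A ♯_ν B := A^{1/2} (A^{-1/2} B A^{-1/2})^ν A^{1/2}`. -/
noncomputable def gmean (ν : ℝ) (A B : H →L[ℂ] H) : H →L[ℂ] H :=
  opSqrt A * cfc (fun x : ℝ => x ^ ν) (opInvSqrt A * B * opInvSqrt A) * opSqrt A

/-- The relative operator entropy `S(A|B) := A^{1/2} ln(A^{-1/2} B A^{-1/2}) A^{1/2}`. -/
noncomputable def relEntropy (A B : H →L[ℂ] H) : H →L[ℂ] H :=
  opSqrt A * cfc Real.log (opInvSqrt A * B * opInvSqrt A) * opSqrt A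

open Set Filter Topology

lemma StrictlyPos.isStrictlyPositive {E : Type*} [NormedAddCommGroup E] [InnerProductSpace ℂ E]
    {T : E →L[ℂ] E} (hT : StrictlyPos T) :
    IsStrictlyPositive T :=
  ⟨(ContinuousLinearMap.nonneg_iff_isPositive T).2 hT.1, hT.2⟩

lemma IsStrictlyPositive.spectrum_real_pos {T : H →L[ℂ] H} (hT : IsStrictlyPositive T)
    {z : ℝ} (hz : z ∈ spectrum ℝ T) : 0 < z := by
  refine lt_of_le_of_ne (spectrum_nonneg_of_nonneg hT.nonneg hz) ?_
  rintro rfl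
  exact spectrum.zero_notMem ℝ hT.isUnit hz

lemma opSqrt_mul_self {P : H →L[ℂ] H} (hP : IsStrictlyPositive P) :
    opSqrt P * opSqrt P = P := by
  have hsa : IsSelfAdjoint P := hP.nonneg.isSelfAdjoint
  rw [opSqrt, ← cfc_mul Real.sqrt Real.sqrt P]
  conv_rhs => rw [← cfc_id ℝ P]
  exact cfc_congr fun z hz => Real.mul_self_sqrt (hP.spectrum_real_pos hz).le

lemma continuousOn_inv_sqrt_spectrum {P : H →L[ℂ] H} (hP : IsStrictlyPositive P) :
    ContinuousOn (fun x : ℝ => (Real.sqrt x)⁻¹) (spectrum ℝ P) :=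
  Real.continuous_sqrt.continuousOn.inv₀ fun _ hz =>
    (Real.sqrt_pos.2 (hP.spectrum_real_pos hz)).ne'

lemma opSqrt_mul_opInvSqrt {P : H →L[ℂ] H} (hP : IsStrictlyPositive P) :
    opSqrt P * opInvSqrt P = 1 := by
  have hsa : IsSelfAdjoint P := hP.nonneg.isSelfAdjoint
  rw [opSqrt, opInvSqrt,
    ← cfc_mul Real.sqrt (fun x : ℝ => (Real.sqrt x)⁻¹) P (by fun_prop)
      (continuousOn_inv_sqrt_spectrum hP), ← cfc_one ℝ P]
  exact cfc_congr fun z hz => mul_inv_cancel₀ (Real.sqrt_pos.2 (hP.spectrum_real_pos hz)).ne'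

lemma opInvSqrt_mul_opSqrt {P : H →L[ℂ] H} (hP : IsStrictlyPositive P) :
    opInvSqrt P * opSqrt P = 1 := by
  rw [← opSqrt_mul_opInvSqrt hP]
  exact cfc_commute_cfc _ _ P

lemma isSelfAdjoint_opInvSqrt (P : H →L[ℂ] H) : IsSelfAdjoint (opInvSqrt P) :=
  cfc_predicate _ P

lemma isUnit_opInvSqrt {P : H →L[ℂ] H} (hP : IsStrictlyPositive P) : IsUnit (opInvSqrt P) :=
  ⟨⟨_, _, opInvSqrt_mul_opSqrt hP, opSqrt_mul_opInvSqrt hP⟩, rfl⟩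

lemma IsStrictlyPositive.opInvSqrt_conj {B P : H →L[ℂ] H} (hB : IsStrictlyPositive B)
    (hP : IsStrictlyPositive P) : IsStrictlyPositive (opInvSqrt P * B * opInvSqrt P) :=
  ⟨(isSelfAdjoint_opInvSqrt P).conjugate_nonneg hB.nonneg,
    ((isUnit_opInvSqrt hP).mul hB.isUnit).mul (isUnit_opInvSqrt hP)⟩

lemma IsStrictlyPositive.pos_smul {P : H →L[ℂ] H} (hP : IsStrictlyPositive P) {l : ℝ}
    (hl : 0 < l) : IsStrictlyPositive (l • P) :=
  ⟨smul_nonneg hl.le hP.nonneg, hP.isUnit.smul (Units.mk0 l hl.ne')⟩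

/-- `P^{1/2} (P^{-1/2} B P^{-1/2} + l)⁻¹ P^{1/2} = P (B + l P)⁻¹ P`. -/
lemma opSqrt_conj_inverse {B P : H →L[ℂ] H} (hB : 0 ≤ B)
    (hP : IsStrictlyPositive P) {l : ℝ} (hl : 0 < l) :
    opSqrt P * Ring.inverse (opInvSqrt P * B * opInvSqrt P + l • 1) * opSqrt P =
      P * Ring.inverse (B + l • P) * P := by
  obtain ⟨u, hu⟩ : IsUnit (B + l • P) := ((hP.pos_smul hl).nonneg_add hB).isUnit
  have h1 := opSqrt_mul_opInvSqrt hP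
  have h2 := opInvSqrt_mul_opSqrt hP
  have h3 := opSqrt_mul_self hP
  set R := opSqrt P
  set Q := opInvSqrt P
  let q : (H →L[ℂ] H)ˣ := ⟨Q, R, h2, h1⟩
  have e : Q * B * Q + l • 1 = (q * u * q : (H →L[ℂ] H)ˣ) := by
    have : Q * P * Q = 1 := by
      rw [← h3, ← mul_assoc, h2, one_mul, h1]
    simp only [Units.val_mul, hu, q, mul_add, add_mul, mul_smul_comm, smul_mul_assoc, this]
  rw [e, ← hu, Ring.inverse_unit, Ring.inverse_unit]
  have : ((q * u * q)⁻¹ : (H →L[ℂ] H)ˣ) = q⁻¹ * (u⁻¹ * q⁻¹) := by group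
  rw [this]
  simp only [Units.val_mul]
  change R * (R * (_ * R)) * R = _
  rw [← h3]
  simp only [mul_assoc]

/-- On a compact set of positive reals, `(1 + l)⁻¹ - (z + l)⁻¹` is dominated by an integrable
function of `l`. -/
lemma exists_bound_inv_sub_inv {s : Set ℝ} (hs : IsCompact s) (hpos : ∀ z ∈ s, 0 < z) :
    ∃ bound : ℝ → ℝ, IntegrableOn bound (Ioi 0) ∧
      ∀ l ∈ Ioi (0 : ℝ), ∀ z ∈ s, ‖(1 + l)⁻¹ - (z + l)⁻¹‖ ≤ bound l := by
  obtain ⟨K, hK⟩ := hs.exists_bound_of_continuousOn (f := fun z : ℝ => z - 1) (by fun_prop)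
  obtain ⟨D, hD⟩ := hs.exists_bound_of_continuousOn (f := fun z : ℝ => z⁻¹)
    (ContinuousOn.inv₀ (by fun_prop) fun z hz => (hpos z hz).ne')
  obtain ⟨c, hc, hc1, hcs⟩ : ∃ c : ℝ, 0 < c ∧ c ≤ 1 ∧ ∀ z ∈ s, c ≤ z := by
    refine ⟨(max D 1)⁻¹, by positivity, inv_le_one_of_one_le₀ (le_max_right _ _),
      fun z hz => inv_le_of_inv_le₀ (hpos z hz) ?_⟩
    exact (le_abs_self _).trans ((hD z hz).trans (le_max_left _ _))
  refine ⟨fun l => K * (l + c) ^ (-2 : ℝ),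
    (integrableOn_add_rpow_Ioi_of_lt (by norm_num) (by linarith)).const_mul K,
    fun l hl z hz => ?_⟩
  have hl : 0 < l := hl
  have hz0 := hpos z hz
  have hcz := hcs z hz
  have hK' := hK z hz
  dsimp only
  rw [Real.rpow_neg (by positivity), Real.rpow_two, ← div_eq_mul_inv,
    inv_sub_inv (by positivity) (by positivity), norm_div, add_sub_add_right_eq_sub,
    Real.norm_of_nonneg (by positivity : 0 ≤ (1 + l) * (z + l)), pow_two]
  have : 0 ≤ K := (norm_nonneg _).trans hK'
  rw [add_comm l c]
  gcongr

lemma continuousOn_uncurry_inv_sub_inv {s : Set ℝ} (hpos : ∀ z ∈ s, 0 < z) :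
    ContinuousOn (Function.uncurry fun l z : ℝ => (1 + l)⁻¹ - (z + l)⁻¹) (Ioi 0 ×ˢ s) := by
  refine ContinuousOn.sub ?_ ?_
  · refine ContinuousOn.inv₀ (by fun_prop) ?_
    rintro ⟨l, z⟩ ⟨hl, hz⟩
    exact (add_pos one_pos hl).ne'
  · refine ContinuousOn.inv₀ (by fun_prop) ?_
    rintro ⟨l, z⟩ ⟨hl, hz⟩
    exact (add_pos (hpos z hz) hl).ne'

/-- The integral representation of the real logarithm. -/
lemma Real.log_eq_integral_Ioi {z : ℝ} (hz : 0 < z) :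
    Real.log z = ∫ l in Ioi (0 : ℝ), ((1 + l)⁻¹ - (z + l)⁻¹) := by
  have hpos : ∀ w ∈ ({z} : Set ℝ), 0 < w := by simpa using hz
  obtain ⟨bound, hbi, hbound⟩ := exists_bound_inv_sub_inv isCompact_singleton hpos
  have hcont : ContinuousOn (fun l : ℝ => (1 + l)⁻¹ - (z + l)⁻¹) (Ioi 0) :=
    (continuousOn_uncurry_inv_sub_inv hpos).comp (f := fun l : ℝ => (l, z)) (by fun_prop)
      fun l hl => ⟨hl, rfl⟩
  have hi : IntegrableOn (fun l : ℝ => (1 + l)⁻¹ - (z + l)⁻¹) (Ioi 0) :=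
    Integrable.mono' hbi (hcont.aestronglyMeasurable measurableSet_Ioi)
      (ae_restrict_of_forall_mem measurableSet_Ioi fun l hl => hbound l hl z rfl)
  have hd : ∀ l ∈ Ici (0 : ℝ), HasDerivAt (fun l => Real.log (1 + l) - Real.log (z + l))
      ((1 + l)⁻¹ - (z + l)⁻¹) l := by
    intro l hl
    have hl : 0 ≤ l := hl
    refine ((((hasDerivAt_id l).const_add 1).log ?_).sub
      (((hasDerivAt_id l).const_add z).log ?_)).congr_deriv (by simp)
    · exact (add_pos_of_pos_of_nonneg one_pos hl).ne'
    · exact (add_pos_of_pos_of_nonneg hz hl).ne'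
  have hlim : Tendsto (fun l => Real.log (1 + l) - Real.log (z + l)) atTop (𝓝 0) := by
    have h1 : Tendsto (fun l : ℝ => 1 + (1 - z) / (z + l)) atTop (𝓝 (1 + 0)) :=
      (tendsto_const_nhds.div_atTop (tendsto_atTop_add_const_left _ z tendsto_id)).const_add 1
    rw [add_zero] at h1
    have h2 := h1.log one_ne_zero
    rw [Real.log_one] at h2
    refine h2.congr' ?_
    filter_upwards [eventually_ge_atTop 0] with l hl
    rw [← Real.log_div (by positivity) (by positivity)]
    congr 1
    have : z + l ≠ 0 := by positivity
    field_simp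
    ring
  rw [integral_Ioi_of_hasDerivAt_of_tendsto' hd hi hlim]
  simp

lemma cfc_inv_sub_inv {C : H →L[ℂ] H} (hC : IsStrictlyPositive C) {l : ℝ} (hl : 0 < l) :
    cfc (fun z : ℝ => (1 + l)⁻¹ - (z + l)⁻¹) C =
      (1 + l)⁻¹ • (1 : H →L[ℂ] H) - Ring.inverse (C + l • 1) := by
  have hsa : IsSelfAdjoint C := hC.nonneg.isSelfAdjoint
  have hne : ∀ z ∈ spectrum ℝ C, z + l ≠ 0 := fun z hz =>
    (add_pos (hC.spectrum_real_pos hz) hl).ne'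
  rw [cfc_sub (fun _ : ℝ => (1 + l)⁻¹) (fun z : ℝ => (z + l)⁻¹) C (by fun_prop)
    (ContinuousOn.inv₀ (by fun_prop) hne), cfc_const _ C, cfc_inv (fun z : ℝ => z + l) C hne,
    cfc_add_const l (fun z : ℝ => z) C, cfc_id' ℝ C, Algebra.algebraMap_eq_smul_one,
    Algebra.algebraMap_eq_smul_one]

lemma integrableOn_smul_one_sub_inverse {C : H →L[ℂ] H} (hC : IsStrictlyPositive C) :
    IntegrableOn (fun l : ℝ => (1 + l)⁻¹ • (1 : H →L[ℂ] H) - Ring.inverse (C + l • 1))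
      (Ioi 0) := by
  have hsa : IsSelfAdjoint C := hC.nonneg.isSelfAdjoint
  have hpos := fun z (hz : z ∈ spectrum ℝ C) => hC.spectrum_real_pos hz
  obtain ⟨bound, hbi, hbound⟩ := exists_bound_inv_sub_inv
    (ContinuousFunctionalCalculus.isCompact_spectrum (R := ℝ) C) hpos
  refine (integrableOn_cfc measurableSet_Ioi (fun l z : ℝ => (1 + l)⁻¹ - (z + l)⁻¹) bound C
    (continuousOn_uncurry_inv_sub_inv hpos) (ae_restrict_of_forall_mem measurableSet_Ioi hbound)
    hbi.2).congr_fun (fun l hl => cfc_inv_sub_inv hC hl) measurableSet_Ioi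

lemma cfc_log_eq_integral {C : H →L[ℂ] H} (hC : IsStrictlyPositive C) :
    cfc Real.log C =
      ∫ l in Ioi (0 : ℝ), ((1 + l)⁻¹ • (1 : H →L[ℂ] H) - Ring.inverse (C + l • 1)) := by
  have hsa : IsSelfAdjoint C := hC.nonneg.isSelfAdjoint
  have hpos := fun z (hz : z ∈ spectrum ℝ C) => hC.spectrum_real_pos hz
  obtain ⟨bound, hbi, hbound⟩ := exists_bound_inv_sub_inv
    (ContinuousFunctionalCalculus.isCompact_spectrum (R := ℝ) C) hpos
  rw [cfc_congr fun z hz => Real.log_eq_integral_Ioi (hpos z hz),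
    cfc_setIntegral measurableSet_Ioi (fun l z : ℝ => (1 + l)⁻¹ - (z + l)⁻¹) bound C
      (continuousOn_uncurry_inv_sub_inv hpos) (ae_restrict_of_forall_mem measurableSet_Ioi hbound)
      hbi.2]
  exact setIntegral_congr_fun measurableSet_Ioi fun l hl => cfc_inv_sub_inv hC hl

lemma relEntropy_eq_integral {B P : H →L[ℂ] H} (hB : IsStrictlyPositive B)
    (hP : IsStrictlyPositive P) :
    IntegrableOn (fun l : ℝ => (1 + l)⁻¹ • P - P * Ring.inverse (B + l • P) * P) (Ioi 0) ∧
      relEntropy P B =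
        ∫ l in Ioi (0 : ℝ), ((1 + l)⁻¹ • P - P * Ring.inverse (B + l • P) * P) := by
  have hC := hB.opInvSqrt_conj hP
  have hbi := integrableOn_smul_one_sub_inverse hC
  let L := ContinuousLinearMap.mulLeftRight ℝ (H →L[ℂ] H) (opSqrt P) (opSqrt P)
  have hL : ∀ l ∈ Ioi (0 : ℝ), L ((1 + l)⁻¹ • (1 : H →L[ℂ] H) -
      Ring.inverse (opInvSqrt P * B * opInvSqrt P + l • 1)) =
      (1 + l)⁻¹ • P - P * Ring.inverse (B + l • P) * P := by
    intro l hl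
    simp only [L, ContinuousLinearMap.mulLeftRight_apply, mul_sub, sub_mul, mul_smul_comm,
      smul_mul_assoc, mul_one, opSqrt_mul_self hP, opSqrt_conj_inverse hB.nonneg hP hl]
  refine ⟨IntegrableOn.congr_fun (L.integrable_comp hbi) hL measurableSet_Ioi, ?_⟩
  rw [relEntropy, cfc_log_eq_integral hC, ← setIntegral_congr_fun measurableSet_Ioi hL,
    L.integral_comp_comm hbi]
  rfl

lemma integral_inverse_segment {R : Type*} [NormedRing R] [NormedAlgebra ℝ R] [CompleteSpace R]
    {A B C P : R}
    (hC : ∀ t ∈ Icc (0 : ℝ) 1, IsUnit ((1 - t) • A + t • B + C)) :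
    ∫ t in (0 : ℝ)..1, P * Ring.inverse ((1 - t) • A + t • B + C) * (B - A) *
      Ring.inverse ((1 - t) • A + t • B + C) * P =
      P * Ring.inverse (A + C) * P - P * Ring.inverse (B + C) * P := by
  have hd : ∀ t ∈ uIcc (0 : ℝ) 1, HasDerivAt
      (fun t : ℝ => -(P * Ring.inverse ((1 - t) • A + t • B + C) * P))
      (P * Ring.inverse ((1 - t) • A + t • B + C) * (B - A) *
        Ring.inverse ((1 - t) • A + t • B + C) * P) t := by
    intro t ht
    rw [uIcc_of_le zero_le_one] at ht
    obtain ⟨u, hu⟩ := hC t ht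
    have h1 : HasDerivAt (fun t : ℝ => (1 - t) • A + t • B + C) (B - A) t := by
      have := ((((hasDerivAt_id t).const_sub 1).smul_const A).add
        ((hasDerivAt_id t).smul_const B)).add_const C
      exact this.congr_deriv (by simp [sub_eq_neg_add])
    have h2 := hasFDerivAt_ringInverse (𝕜 := ℝ) u
    rw [hu] at h2
    refine (((h2.comp_hasDerivAt t h1).const_mul P).mul_const P).neg.congr_deriv ?_
    rw [← hu, Ring.inverse_unit]
    simp [mul_assoc]
  have hc : ContinuousOn (fun t : ℝ => P * Ring.inverse ((1 - t) • A + t • B + C) * (B - A) *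
      Ring.inverse ((1 - t) • A + t • B + C) * P) (uIcc 0 1) := by
    have hi : ContinuousOn (fun t : ℝ => Ring.inverse ((1 - t) • A + t • B + C)) (uIcc 0 1) := by
      intro t ht
      rw [uIcc_of_le zero_le_one] at ht
      obtain ⟨u, hu⟩ := hC t ht
      have h2 := NormedRing.inverse_continuousAt u
      rw [hu] at h2
      exact (ContinuousAt.comp (f := fun t : ℝ => (1 - t) • A + t • B + C) h2
        (by fun_prop)).continuousWithinAt
    fun_prop
  rw [intervalIntegral.integral_eq_sub_of_hasDerivAt hd hc.intervalIntegrable]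
  simp
  abel

/-- **Theorem 2.4.** For all strictly positive operators `A, B, P`,
`S(P|B) - S(P|A) = ∫₀^∞ [∫₀¹ P((1-t)A + tB + λP)⁻¹ (B - A) ((1-t)A + tB + λP)⁻¹ P dt] dλ`. -/
theorem stmt_12 (A B P : H →L[ℂ] H) (hA : StrictlyPos A) (hB : StrictlyPos B)
    (hP : StrictlyPos P) :
    relEntropy P B - relEntropy P A =
      ∫ l in Set.Ioi (0:ℝ),
        (∫ t in (0:ℝ)..1, P * Ring.inverse ((1 - t) • A + t • B + l • P) * (B - A) *
          Ring.inverse ((1 - t) • A + t • B + l • P) * P) := by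
  have hA' := hA.isStrictlyPositive
  have hB' := hB.isStrictlyPositive
  have hP' := hP.isStrictlyPositive
  obtain ⟨hiA, hSA⟩ := relEntropy_eq_integral hA' hP'
  obtain ⟨hiB, hSB⟩ := relEntropy_eq_integral hB' hP'
  rw [hSA, hSB, ← integral_sub hiB hiA]
  refine setIntegral_congr_fun measurableSet_Ioi fun l hl => ?_
  rw [integral_inverse_segment fun t ht => ((hP'.pos_smul hl).nonneg_add (add_nonneg
    (smul_nonneg (sub_nonneg.2 ht.2) hA'.nonneg) (smul_nonneg ht.1 hB'.nonneg))).isUnit]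
  abel
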